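/- Let X be a Banach space (over ℝ or ℂ) for which there is a point x ∈ S_X such that x is not an extreme point of B_X and, for every ε > 0, the ball B(x,ε) contains an extreme point of B_X. Then, for every locally compact Hausdorff space K with K nonempty, the space C_0(K,X) fails property CWO-S. -/

import Mathlib

open Metric Topology

/-- The weak topology on a normed space `E` over `𝕜`. -/
def weakTop (𝕜 E : Type*) [NontriviallyNormedField 𝕜] [NormedAddCommGroup E]
    [NormedSpace 𝕜 E] : TopologicalSpace E :=
  TopologicalSpace.induced (fun (x : E) (f : E →L[𝕜] 𝕜) => f x) inferInstance

/-- `U` is a relatively weakly open subset of the closed unit ball of `E`. -/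
def RelWeakOpen (𝕜 : Type*) {E : Type*} [NontriviallyNormedField 𝕜] [NormedAddCommGroup E]
    [NormedSpace 𝕜 E] (U : Set E) : Prop :=
  U ⊆ closedBall 0 1 ∧ ∃ V : Set E, IsOpen[weakTop 𝕜 E] V ∧ U = V ∩ closedBall 0 1

/-- `x` is an interior point of `C` in the relative weak topology of the closed
unit ball of `E`. -/
def RelWeakInterior (𝕜 : Type*) {E : Type*} [NontriviallyNormedField 𝕜] [NormedAddCommGroup E]
    [NormedSpace 𝕜 E] (C : Set E) (x : E) : Prop :=
  ∃ V : Set E, IsOpen[weakTop 𝕜 E] V ∧ x ∈ V ∧ V ∩ closedBall 0 1 ⊆ C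

/-- The convex combination `∑ j, lam j • U j` of the sets `U j` with coefficients `lam j`. -/
def ConvComb (𝕜 : Type*) {E : Type*} [RCLike 𝕜] [NormedAddCommGroup E] [NormedSpace 𝕜 E]
    {n : ℕ} (lam : Fin n → ℝ) (U : Fin n → Set E) : Set E :=
  {x | ∃ u : Fin n → E, (∀ j, u j ∈ U j) ∧ x = ∑ j, ((lam j : ℝ) : 𝕜) • u j}

/-- `X` has property CWO. -/
def PropCWO (𝕜 E : Type*) [RCLike 𝕜] [NormedAddCommGroup E] [NormedSpace 𝕜 E] : Prop :=
  ∀ (n : ℕ) (U : Fin n → Set E) (lam : Fin n → ℝ),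
    (∀ j, RelWeakOpen 𝕜 (U j)) → (∀ j, 0 < lam j) → (∑ j, lam j) = 1 →
    ∃ V : Set E, IsOpen[weakTop 𝕜 E] V ∧ ConvComb 𝕜 lam U = V ∩ closedBall 0 1

/-- `X` has property CWO-S. -/
def PropCWOS (𝕜 E : Type*) [RCLike 𝕜] [NormedAddCommGroup E] [NormedSpace 𝕜 E] : Prop :=
  ∀ (n : ℕ) (U : Fin n → Set E) (lam : Fin n → ℝ),
    (∀ j, RelWeakOpen 𝕜 (U j)) → (∀ j, 0 < lam j) → (∑ j, lam j) = 1 →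
    ∀ x ∈ ConvComb 𝕜 lam U, ‖x‖ = 1 → RelWeakInterior 𝕜 (ConvComb 𝕜 lam U) x

/-- `X` has property CWO-B. -/
def PropCWOB (𝕜 E : Type*) [RCLike 𝕜] [NormedAddCommGroup E] [NormedSpace 𝕜 E] : Prop :=
  ∀ (n : ℕ) (U : Fin n → Set E) (lam : Fin n → ℝ),
    (∀ j, RelWeakOpen 𝕜 (U j)) → (∀ j, 0 < lam j) → (∑ j, lam j) = 1 →
    ∀ x ∈ ConvComb 𝕜 lam U, ‖x‖ < 1 → RelWeakInterior 𝕜 (ConvComb 𝕜 lam U) x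

/-- A point `x` of the closed unit ball has property (co n). -/
def HasCoN (𝕜 : Type*) {E : Type*} [RCLike 𝕜] [NormedAddCommGroup E] [NormedSpace 𝕜 E]
    (n : ℕ) (x : E) : Prop :=
  ∀ (xs : Fin n → E) (lam : Fin n → ℝ),
    (∀ j, ‖xs j‖ ≤ 1) → (∀ j, 0 < lam j) → (∑ j, lam j) = 1 →
    x = (∑ j, ((lam j : ℝ) : 𝕜) • xs j) →
    ∀ ε : ℝ, 0 < ε → ∃ δ : ℝ, 0 < δ ∧
      ∃ v : Fin n → ((ball x δ ∩ closedBall 0 1 : Set E) → E),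
        (∀ j, Continuous (v j)) ∧
        ∀ u : (ball x δ ∩ closedBall 0 1 : Set E),
          (∀ j, ‖v j u‖ ≤ 1) ∧
          (u : E) = (∑ j, ((lam j : ℝ) : 𝕜) • v j u) ∧
          ∀ j, ‖v j u - xs j‖ < ε

/-- A point `x` of the closed unit ball has property (co). -/
def HasCoPt (𝕜 : Type*) {E : Type*} [RCLike 𝕜] [NormedAddCommGroup E] [NormedSpace 𝕜 E]
    (x : E) : Prop :=
  ∀ n : ℕ, 2 ≤ n → HasCoN 𝕜 n x

/-- The space has property (co). -/
def PropCo (𝕜 E : Type*) [RCLike 𝕜] [NormedAddCommGroup E] [NormedSpace 𝕜 E] : Prop :=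
  ∀ x : E, ‖x‖ ≤ 1 → HasCoPt 𝕜 x

/-- `x` is an extreme point of the closed unit ball of `E`
(with respect to the real convex structure). -/
def IsExtremePt (𝕜 : Type*) {E : Type*} [RCLike 𝕜] [NormedAddCommGroup E] [NormedSpace 𝕜 E]
    (x : E) : Prop :=
  ‖x‖ ≤ 1 ∧ ∀ y z : E, ‖y‖ ≤ 1 → ‖z‖ ≤ 1 → ∀ t : ℝ, 0 < t → t < 1 →
    x = ((t : ℝ) : 𝕜) • y + (((1 - t : ℝ) : ℝ) : 𝕜) • z → y = x ∧ z = x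

/-- A topological space is scattered if every non-empty subset `A` has a point
isolated in `A`. -/
def Scattered (K : Type*) [TopologicalSpace K] : Prop :=
  ∀ A : Set K, A.Nonempty → ∃ a ∈ A, ∃ U : Set K, IsOpen U ∧ U ∩ A = {a}


lemma aux_norm_apply_le {E K : Type*} [NormedAddCommGroup E] [TopologicalSpace K]
    (f : ZeroAtInftyContinuousMap K E) (k : K) : ‖f k‖ ≤ ‖f‖ :=
  f.toBCF.norm_coe_le_norm k

lemma aux_norm_le {E K : Type*} [NormedAddCommGroup E] [TopologicalSpace K]
    (f : ZeroAtInftyContinuousMap K E) {C : ℝ} (hC : 0 ≤ C) (h : ∀ k, ‖f k‖ ≤ C) : ‖f‖ ≤ C :=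
  (BoundedContinuousFunction.norm_le (f := f.toBCF) hC).2 h

lemma aux_weakTop_open {𝕜 E : Type*} [RCLike 𝕜] [NormedAddCommGroup E] [NormedSpace 𝕜 E]
    {V : Set E} (hV : IsOpen[weakTop 𝕜 E] V) : IsOpen V := by
  obtain ⟨W, hW, rfl⟩ := hV
  exact hW.preimage (continuous_pi fun f => f.continuous)

lemma aux_slice_open {𝕜 E : Type*} [RCLike 𝕜] [NormedAddCommGroup E] [NormedSpace 𝕜 E]
    (L : E →L[𝕜] 𝕜) (c : 𝕜) (r : ℝ) : IsOpen[weakTop 𝕜 E] (L ⁻¹' ball c r) :=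
  ⟨(fun g : (E →L[𝕜] 𝕜) → 𝕜 => g L) ⁻¹' ball c r, isOpen_ball.preimage (continuous_apply L), rfl⟩

lemma aux_main {𝕜 E F : Type*} [RCLike 𝕜] [NormedAddCommGroup E] [NormedSpace 𝕜 E]
    [NormedAddCommGroup F] [NormedSpace 𝕜 F]
    (m : E →ₗ[𝕜] F) (ev : F →ₗ[𝕜] E) (hm : ∀ v, ‖m v‖ ≤ ‖v‖) (hev : ∀ f, ‖ev f‖ ≤ ‖f‖)
    (hem : ∀ v, ev (m v) = v)
    (x : E) (hx : ‖x‖ = 1) (hnotext : ¬ IsExtremePt 𝕜 x)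
    (hclose : ∀ ε : ℝ, 0 < ε → ∃ y : E, IsExtremePt 𝕜 y ∧ ‖y - x‖ < ε) :
    ¬ PropCWOS 𝕜 F := by
  intro H
  have h1 : ∃ y z : E, ‖y‖ ≤ 1 ∧ ‖z‖ ≤ 1 ∧ ∃ t : ℝ, 0 < t ∧ t < 1 ∧
      x = ((t : ℝ) : 𝕜) • y + (((1 - t : ℝ) : ℝ) : 𝕜) • z ∧ y ≠ z := by
    by_contra hcon
    push Not at hcon
    refine hnotext ⟨hx.le, fun y z hy hz t ht0 ht1 hxe => ?_⟩
    have hyz := hcon y z hy hz t ht0 ht1 hxe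
    subst hyz
    have : x = y := by
      rw [hxe, ← add_smul, ← RCLike.ofReal_add]
      simp
    exact ⟨this.symm, this.symm⟩
  obtain ⟨y, z, hy, hz, t, ht0, ht1, hxe, hyz⟩ := h1
  obtain ⟨h, hh⟩ := SeparatingDual.exists_separating_of_ne (R := 𝕜) hyz
  let evc : F →L[𝕜] E := ev.mkContinuous 1 (by simpa using hev)
  have hevc : ∀ f, evc f = ev f := fun _ => rfl
  let L : F →L[𝕜] 𝕜 := h.comp evc
  have hL : ∀ f, L f = h (ev f) := fun _ => rfl
  set r : ℝ := dist (h y) (h z) / 2 with hr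
  have hr0 : 0 < r := half_pos (dist_pos.2 hh)
  have key := H 2 ![(L ⁻¹' ball (h y) r) ∩ closedBall 0 1, (L ⁻¹' ball (h z) r) ∩ closedBall 0 1]
    ![t, 1 - t] ?_ ?_ ?_ (m x) ?_ ?_
  · obtain ⟨V, hV, hxV, hVC⟩ := key
    obtain ⟨ε, hε, hball⟩ := Metric.isOpen_iff.1 (aux_weakTop_open hV) _ hxV
    obtain ⟨e, he, hex⟩ := hclose ε hε
    have hmem : m e ∈ V ∩ closedBall 0 1 := by
      refine ⟨hball ?_, ?_⟩
      · rw [mem_ball, dist_eq_norm, ← map_sub]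
        exact (hm _).trans_lt hex
      · rw [mem_closedBall_zero_iff]
        exact (hm e).trans he.1
    obtain ⟨u, hu, hue⟩ := hVC hmem
    have hu0 := hu 0
    have hu1 := hu 1
    simp only [Fin.sum_univ_two, Matrix.cons_val_zero, Matrix.cons_val_one] at hue hu0 hu1
    obtain ⟨ha0, hb0⟩ := hu0
    obtain ⟨ha1, hb1⟩ := hu1
    rw [mem_closedBall_zero_iff] at hb0 hb1
    have hee := congrArg ev hue
    rw [hem, map_add, map_smul, map_smul] at hee
    obtain ⟨e0, e1⟩ := he.2 _ _ ((hev _).trans hb0) ((hev _).trans hb1) t ht0 ht1 hee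
    rw [Set.mem_preimage, hL, e0, mem_ball] at ha0
    rw [Set.mem_preimage, hL, e1, mem_ball] at ha1
    have := dist_triangle_left (h y) (h z) (h e)
    linarith
  · intro j
    fin_cases j
    · exact ⟨Set.inter_subset_right, _, aux_slice_open L _ _, rfl⟩
    · exact ⟨Set.inter_subset_right, _, aux_slice_open L _ _, rfl⟩
  · intro j
    fin_cases j
    · exact ht0
    · exact sub_pos.2 ht1
  · simp
  · refine ⟨![m y, m z], ?_, ?_⟩
    · intro j
      fin_cases j
      · refine ⟨?_, ?_⟩
        · show L (m y) ∈ ball (h y) r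
          rw [hL, hem]; exact mem_ball_self hr0
        · show m y ∈ closedBall 0 1
          rw [mem_closedBall_zero_iff]; exact (hm y).trans hy
      · refine ⟨?_, ?_⟩
        · show L (m z) ∈ ball (h z) r
          rw [hL, hem]; exact mem_ball_self hr0
        · show m z ∈ closedBall 0 1
          rw [mem_closedBall_zero_iff]; exact (hm z).trans hz
    · simp only [Fin.sum_univ_two, Matrix.cons_val_zero, Matrix.cons_val_one]
      rw [← map_smul, ← map_smul, ← map_add, ← hxe]
  · refine le_antisymm ((hm x).trans hx.le) ?_
    rw [← hx]
    calc ‖x‖ = ‖ev (m x)‖ := by rw [hem]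
      _ ≤ _ := hev _

open ZeroAtInfty in
/-- If `x ∈ S_X` is not an extreme point of `B_X` but extreme points of
`B_X` come arbitrarily close to `x`, then for every nonempty locally compact Hausdorff
space `K`, the space `C₀(K, X)` fails property CWO-S. -/
theorem stmt11 {𝕜 E K : Type*} [RCLike 𝕜] [NormedAddCommGroup E] [NormedSpace 𝕜 E]
    [CompleteSpace E] [TopologicalSpace K] [LocallyCompactSpace K] [T2Space K] [Nonempty K]
    (x : E) (hx : ‖x‖ = 1) (hnotext : ¬ IsExtremePt 𝕜 x)
    (hclose : ∀ ε : ℝ, 0 < ε → ∃ y : E, IsExtremePt 𝕜 y ∧ ‖y - x‖ < ε) :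
    ¬ PropCWOS 𝕜 C₀(K, E) := by
  obtain ⟨k₀⟩ := ‹Nonempty K›
  obtain ⟨φ, hφ1, -, hφc, hφI⟩ := exists_continuous_one_zero_of_isCompact
    (isCompact_singleton (x := k₀)) isClosed_empty (Set.disjoint_empty _)
  have hφ1 : φ k₀ = 1 := hφ1 rfl
  let m : E →ₗ[𝕜] C₀(K, E) :=
    { toFun := fun v =>
        { toFun := fun k => ((φ k : ℝ) : 𝕜) • v
          continuous_toFun := by fun_prop
          zero_at_infty' := by
            have h0 : Filter.Tendsto φ (Filter.cocompact K) (𝓝 0) := hφc.is_zero_at_infty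
            have h2 : Filter.Tendsto (fun k => ((φ k : ℝ) : 𝕜) • v) (Filter.cocompact K)
                (𝓝 (((0 : ℝ) : 𝕜) • v)) :=
              (((RCLike.continuous_ofReal (K := 𝕜)).tendsto 0).comp h0).smul_const v
            simpa using h2 }
      map_add' := fun v w => by ext k; exact smul_add _ _ _
      map_smul' := fun c v => by ext k; exact smul_comm _ _ _ }
  have hma : ∀ v k, m v k = ((φ k : ℝ) : 𝕜) • v := fun _ _ => rfl
  let ev : C₀(K, E) →ₗ[𝕜] E :=
    { toFun := fun f => f k₀
      map_add' := fun _ _ => rfl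
      map_smul' := fun _ _ => rfl }
  refine aux_main m ev (fun v => aux_norm_le _ (norm_nonneg v) fun k => ?_)
    (fun f => aux_norm_apply_le f k₀) (fun v => ?_) x hx hnotext hclose
  · rw [hma, norm_smul, RCLike.norm_ofReal, abs_of_nonneg (hφI k).1]
    exact mul_le_of_le_one_left (norm_nonneg v) (hφI k).2
  · show m v k₀ = v
    rw [hma, hφ1]; simp
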